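/- arXiv:2002.12706 — 5 statements merged into one kernel-verified Lean document; each statement's English description precedes it below -/
import Mathlib

section
/- Let G = (V, E) be a finite simple graph and let C_1, C_2, ..., C_k be subsets of V, each inducing a clique in G, such that the edge sets of these cliques are pairwise disjoint and their union is E. If (A, B) is a cut of G such that -1 ≤ |A ∩ C_i| - |B ∩ C_i| ≤ 1 for every 1 ≤ i ≤ k, then (A, B) is a maximum cut of G, i.e., its size is at least the size of every cut of G. -/
/-- The size of the cut `(A, Aᶜ)` of `G`: the number of edges of `G` with one endpoint
in `A` and the other endpoint outside `A`.  Each crossing edge is counted exactly once,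
as the ordered pair whose first coordinate lies in `A`. -/
def cutSize {V : Type*} [Fintype V] [DecidableEq V] (G : SimpleGraph V) [DecidableRel G.Adj]
    (A : Finset V) : ℕ :=
  (Finset.univ.filter fun p : V × V => G.Adj p.1 p.2 ∧ p.1 ∈ A ∧ p.2 ∉ A).card

/-- The edge set of the clique `C`: the set of edges of `G` with both endpoints in `C`. -/
def cliqueEdges {V : Type*} (G : SimpleGraph V) (C : Finset V) : Set (Sym2 V) :=
  {e ∈ G.edgeSet | ∀ x ∈ e, x ∈ C}

/-- Every edge of `G` lies in exactly one clique of the partition, so the size of a cut is the sum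
of the numbers of pairs it separates within the cliques. -/
theorem cutSize_eq_sum_of_clique_partition
    {V ι : Type*} [Fintype V] [DecidableEq V] [Fintype ι] (G : SimpleGraph V) [DecidableRel G.Adj]
    (C : ι → Finset V) (hclique : ∀ i, G.IsClique (C i))
    (hdisj : ∀ i j, i ≠ j → Disjoint (cliqueEdges G (C i)) (cliqueEdges G (C j)))
    (hunion : (⋃ i, cliqueEdges G (C i)) = G.edgeSet) (D : Finset V) :
    cutSize G D = ∑ i, (D ∩ C i).card * (C i \ D).card := by
  have mem_cliqueEdges_iff {x y : V} (i : ι) :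
      s(x, y) ∈ cliqueEdges G (C i) ↔ G.Adj x y ∧ x ∈ C i ∧ y ∈ C i := by
    simp [cliqueEdges]
  have adj_of_mem {x y : V} {i : ι} (hx : x ∈ D ∩ C i) (hy : y ∈ C i \ D) : G.Adj x y := by
    simp only [Finset.mem_inter, Finset.mem_sdiff] at hx hy
    exact hclique i hx.2 hy.1 fun h => hy.2 (h ▸ hx.1)
  have crossing_eq : (Finset.univ.filter fun p : V × V => G.Adj p.1 p.2 ∧ p.1 ∈ D ∧ p.2 ∉ D) =
      Finset.univ.biUnion fun i => (D ∩ C i) ×ˢ (C i \ D) := by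
    ext ⟨x, y⟩
    simp only [Finset.mem_filter, Finset.mem_univ, true_and, Finset.mem_biUnion,
      Finset.mem_product]
    constructor
    · rintro ⟨hadj, hx, hy⟩
      have hmem : s(x, y) ∈ ⋃ i, cliqueEdges G (C i) := hunion ▸ hadj
      obtain ⟨i, hi⟩ := Set.mem_iUnion.mp hmem
      obtain ⟨-, hxi, hyi⟩ := (mem_cliqueEdges_iff i).mp hi
      exact ⟨i, Finset.mem_inter.mpr ⟨hx, hxi⟩, Finset.mem_sdiff.mpr ⟨hyi, hy⟩⟩
    · rintro ⟨i, hx, hy⟩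
      exact ⟨adj_of_mem hx hy, (Finset.mem_inter.mp hx).1, (Finset.mem_sdiff.mp hy).2⟩
  rw [cutSize, crossing_eq, Finset.card_biUnion]
  · simp only [Finset.card_product]
  · intro i _ j _ hij
    refine Finset.disjoint_left.mpr ?_
    rintro ⟨x, y⟩ hi hj
    obtain ⟨hxi, hyi⟩ := Finset.mem_product.mp hi
    obtain ⟨hxj, hyj⟩ := Finset.mem_product.mp hj
    have hadj := adj_of_mem hxi hyi
    exact Set.disjoint_left.mp (hdisj i j hij)
      ((mem_cliqueEdges_iff i).mpr
        ⟨hadj, (Finset.mem_inter.mp hxi).2, (Finset.mem_sdiff.mp hyi).1⟩)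
      ((mem_cliqueEdges_iff j).mpr
        ⟨hadj, (Finset.mem_inter.mp hxj).2, (Finset.mem_sdiff.mp hyj).1⟩)

/-- Among pairs of integers with a given sum, a balanced pair has the largest product. -/
theorem mul_le_mul_of_add_eq_add_of_balanced {a b c d : ℤ} (hsum : c + d = a + b)
    (hlower : -1 ≤ a - b) (hupper : a - b ≤ 1) : c * d ≤ a * b := by
  obtain rfl : d = a + b - c := by omega
  rcases le_or_gt c (min a b) with h | h
  · have := mul_nonneg (sub_nonneg.mpr (h.trans (min_le_left a b)))
      (sub_nonneg.mpr (h.trans (min_le_right a b)))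
    linarith
  · have hc : max a b ≤ c := by omega
    have := mul_nonneg (sub_nonneg.mpr ((le_max_left a b).trans hc))
      (sub_nonneg.mpr ((le_max_right a b).trans hc))
    linarith

/-- If `C_1, …, C_k` are cliques of `G` whose edge sets are pairwise disjoint and cover all
edges of `G`, and `(A, Aᶜ)` is a cut with `-1 ≤ |A ∩ C i| - |Aᶜ ∩ C i| ≤ 1` for every `i`,
then `(A, Aᶜ)` is a maximum cut. -/
theorem maxcut_of_balanced_on_clique_partition
    {V : Type*} [Fintype V] [DecidableEq V] (G : SimpleGraph V) [DecidableRel G.Adj]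
    (k : ℕ) (C : Fin k → Finset V)
    (hclique : ∀ i, G.IsClique (C i))
    (hdisj : ∀ i j, i ≠ j → Disjoint (cliqueEdges G (C i)) (cliqueEdges G (C j)))
    (hunion : (⋃ i, cliqueEdges G (C i)) = G.edgeSet)
    (A : Finset V)
    (hbal : ∀ i, -1 ≤ ((A ∩ C i).card : ℤ) - ((C i \ A).card : ℤ) ∧
      ((A ∩ C i).card : ℤ) - ((C i \ A).card : ℤ) ≤ 1) :
    ∀ D : Finset V, cutSize G D ≤ cutSize G A := by
  intro D
  rw [cutSize_eq_sum_of_clique_partition G C hclique hdisj hunion D,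
    cutSize_eq_sum_of_clique_partition G C hclique hdisj hunion A]
  refine Finset.sum_le_sum fun i _ => ?_
  have card_split (S : Finset V) : (S ∩ C i).card + (C i \ S).card = (C i).card := by
    rw [Finset.inter_comm, Finset.card_inter_add_card_sdiff]
  have hsum : ((D ∩ C i).card : ℤ) + (C i \ D).card = (A ∩ C i).card + (C i \ A).card := by
    exact_mod_cast (card_split D).trans (card_split A).symm
  exact_mod_cast mul_le_mul_of_add_eq_add_of_balanced hsum (hbal i).1 (hbal i).2
end

section
/- Let G = (V, E) be a finite simple graph and let C_1, C_2, ..., C_k be subsets of V, each inducing a clique in G, such that the edge sets of these cliques are pairwise disjoint and their union is E. If (A, B) is a bisection of G such that -1 ≤ |A ∩ C_i| - |B ∩ C_i| ≤ 1 for every 1 ≤ i ≤ k, then (A, B) is a maximum bisection of G, i.e., its size is at least the size of every bisection of G. -/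
/-- `(A, Aᶜ)` is a bisection: the two sides differ in size by at most one. -/
def IsBisection {V : Type*} [Fintype V] [DecidableEq V] (A : Finset V) : Prop :=
  -1 ≤ (A.card : ℤ) - (Aᶜ.card : ℤ) ∧ (A.card : ℤ) - (Aᶜ.card : ℤ) ≤ 1

/-- If the edge sets of the cliques `C i` partition the edges of `G`, the size of a cut is the sum
over the cliques of the sizes of the cuts it induces on them. -/
lemma cutSize_eq_sum_clique_partition
    {V : Type*} [Fintype V] [DecidableEq V] (G : SimpleGraph V) [DecidableRel G.Adj]
    {ι : Type*} [Fintype ι] (C : ι → Finset V)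
    (hclique : ∀ i, G.IsClique (C i))
    (hdisj : ∀ i j, i ≠ j → Disjoint (cliqueEdges G (C i)) (cliqueEdges G (C j)))
    (hunion : (⋃ i, cliqueEdges G (C i)) = G.edgeSet) (D : Finset V) :
    cutSize G D = ∑ i, (D ∩ C i).card * (C i \ D).card := by
  have hcut : (Finset.univ.filter fun p : V × V => G.Adj p.1 p.2 ∧ p.1 ∈ D ∧ p.2 ∉ D) =
      Finset.univ.biUnion fun i => (D ∩ C i) ×ˢ (C i \ D) := by
    ext ⟨x, y⟩
    simp only [Finset.mem_filter, Finset.mem_univ, true_and, Finset.mem_biUnion,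
      Finset.mem_product, Finset.mem_inter, Finset.mem_sdiff]
    constructor
    · rintro ⟨hxy, hx, hy⟩
      have he : s(x, y) ∈ ⋃ i, cliqueEdges G (C i) := by
        rw [hunion]
        exact hxy
      obtain ⟨i, -, hi⟩ := Set.mem_iUnion.1 he
      exact ⟨i, ⟨hx, hi x (Sym2.mem_mk_left x y)⟩, hi y (Sym2.mem_mk_right x y), hy⟩
    · rintro ⟨i, ⟨hx, hxi⟩, hyi, hy⟩
      exact ⟨hclique i hxi hyi (ne_of_mem_of_not_mem hx hy), hx, hy⟩
  rw [cutSize, hcut, Finset.card_biUnion]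
  · simp only [Finset.card_product]
  · intro i _ j _ hij
    refine Finset.disjoint_left.2 ?_
    rintro ⟨x, y⟩ hi hj
    simp only [Finset.mem_product, Finset.mem_inter, Finset.mem_sdiff] at hi hj
    obtain ⟨⟨hx, hxi⟩, hyi, hy⟩ := hi
    obtain ⟨⟨-, hxj⟩, hyj, -⟩ := hj
    have hxy : G.Adj x y := hclique i hxi hyi (ne_of_mem_of_not_mem hx hy)
    exact Set.disjoint_left.1 (hdisj i j hij)
      (show s(x, y) ∈ cliqueEdges G (C i) from ⟨hxy, by simp [hxi, hyi]⟩)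
      ⟨hxy, by simp [hxj, hyj]⟩

/-- Among pairs of natural numbers with a given sum, a balanced pair has the largest product. -/
lemma Nat.mul_le_mul_of_add_eq_of_balanced {a b c d : ℕ} (hadd : a + b = c + d)
    (hl : -1 ≤ (c : ℤ) - d) (hu : (c : ℤ) - d ≤ 1) : a * b ≤ c * d := by
  rcases lt_trichotomy c d with h | h | h
  · obtain rfl : d = c + 1 := by omega
    rcases le_or_gt a c with h' | h'
    · obtain ⟨t, rfl⟩ := Nat.exists_eq_add_of_le h'
      obtain rfl : b = a + 2 * t + 1 := by omega
      nlinarith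
    · obtain ⟨t, rfl⟩ := Nat.exists_eq_add_of_lt h'
      obtain rfl : c = b + t := by omega
      nlinarith
  · subst h
    zify at *
    nlinarith [sq_nonneg ((a : ℤ) - b)]
  · obtain rfl : c = d + 1 := by omega
    rcases le_or_gt a d with h' | h'
    · obtain ⟨t, rfl⟩ := Nat.exists_eq_add_of_le h'
      obtain rfl : b = a + 2 * t + 1 := by omega
      nlinarith
    · obtain ⟨t, rfl⟩ := Nat.exists_eq_add_of_lt h'
      obtain rfl : d = b + t := by omega
      nlinarith

/-- If `C_1, …, C_k` are cliques of `G` whose edge sets are pairwise disjoint and cover all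
edges of `G`, and `(A, Aᶜ)` is a bisection with `-1 ≤ |A ∩ C i| - |Aᶜ ∩ C i| ≤ 1` for every
`i`, then `(A, Aᶜ)` is a maximum bisection. -/
theorem maxbisection_of_balanced_on_clique_partition
    {V : Type*} [Fintype V] [DecidableEq V] (G : SimpleGraph V) [DecidableRel G.Adj]
    (k : ℕ) (C : Fin k → Finset V)
    (hclique : ∀ i, G.IsClique (C i))
    (hdisj : ∀ i j, i ≠ j → Disjoint (cliqueEdges G (C i)) (cliqueEdges G (C j)))
    (hunion : (⋃ i, cliqueEdges G (C i)) = G.edgeSet)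
    (A : Finset V) (hA : IsBisection A)
    (hbal : ∀ i, -1 ≤ ((A ∩ C i).card : ℤ) - ((C i \ A).card : ℤ) ∧
      ((A ∩ C i).card : ℤ) - ((C i \ A).card : ℤ) ≤ 1) :
    ∀ D : Finset V, IsBisection D → cutSize G D ≤ cutSize G A := by
  intro D _
  simp only [cutSize_eq_sum_clique_partition G C hclique hdisj hunion]
  refine Finset.sum_le_sum fun i _ =>
    Nat.mul_le_mul_of_add_eq_of_balanced ?_ (hbal i).1 (hbal i).2
  rw [Finset.inter_comm D, Finset.inter_comm A, Finset.card_inter_add_card_sdiff,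
    Finset.card_inter_add_card_sdiff]
end

section
/- For every finite simple graph G, the line graph L(G) admits a bisection whose size equals the maximum size of a cut of L(G). In particular, the maximum size of a bisection of L(G) equals the maximum size of a cut of L(G). -/
instance {V : Type*} [Fintype V] [DecidableEq V] (G : SimpleGraph V) :
    DecidableRel (G.lineGraph).Adj :=
  fun _ _ => decidable_of_iff _ (SimpleGraph.lineGraph_adj_iff_exists).symm

open Finset

section

variable {V : Type*} [DecidableEq V] {G : SimpleGraph V}

/-- The sum of the weights `c e` over the edges `e ∈ S` incident with `v`. -/
def incidentSum (c : G.edgeSet → ℤ) (S : Finset G.edgeSet) (v : V) : ℤ :=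
  ∑ e ∈ S, if v ∈ (e : Sym2 V) then c e else 0

lemma incidentSum_add_sdiff (c : G.edgeSet → ℤ) {S T : Finset G.edgeSet}
    (h : T ⊆ S) (v : V) :
    incidentSum c (S \ T) v + incidentSum c T v = incidentSum c S v :=
  Finset.sum_sdiff h

lemma sum_incidentSum [Fintype V] (c : G.edgeSet → ℤ) (S : Finset G.edgeSet) :
    ∑ v, incidentSum c S v = 2 * ∑ e ∈ S, c e := by
  simp only [incidentSum]
  rw [Finset.sum_comm, Finset.mul_sum]
  refine Finset.sum_congr rfl fun e _ => ?_
  have h := Sym2.card_toFinset_of_not_isDiag (e : Sym2 V) (G.not_isDiag_of_mem_edgeSet e.2)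
  have h2 : (univ.filter fun v => v ∈ (e : Sym2 V)) = (e : Sym2 V).toFinset := by
    ext; simp
  rw [← Finset.sum_filter, Finset.sum_const, h2, h]
  simp

/-- A vertex of positive incident sum is the start of an alternating trail that meets the sign
and size constraints imposed by the incident sums; the trail is obtained as an edge set of
maximal size whose incident sums are those of an alternating trail. -/
lemma exists_conformal_trail [Fintype V] (c : G.edgeSet → ℤ)
    (hc : ∀ e, c e = 1 ∨ c e = -1) (S : Finset G.edgeSet) (v : V)
    (hv : 0 < incidentSum c S v) :
    ∃ T ⊆ S, T.Nonempty ∧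
      (∀ x, 0 ≤ incidentSum c T x ∧ incidentSum c T x ≤ incidentSum c S x ∨
        incidentSum c S x ≤ incidentSum c T x ∧ incidentSum c T x ≤ 0) ∧
      (∑ e ∈ T, c e = 1 ∨ ∑ e ∈ T, c e = 0) := by
  classical
  let P : Finset G.edgeSet → Prop := fun T => ∃ u : V, ∃ s : ℤ, (s = 1 ∨ s = -1) ∧
    ∀ x, incidentSum c T x = (if x = v then 1 else 0) + (if x = u then s else 0)
  have hne : (S.powerset.filter P).Nonempty := by
    refine ⟨∅, ?_⟩
    simp only [mem_filter, mem_powerset, empty_subset, true_and]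
    refine ⟨v, -1, Or.inr rfl, fun x => ?_⟩
    by_cases h : x = v <;> simp [incidentSum, h]
  obtain ⟨T, hT, hmax⟩ := Finset.exists_max_image _ Finset.card hne
  simp only [mem_filter, mem_powerset] at hT hmax
  obtain ⟨hTS, u, s, hs, hx⟩ := hT
  have hblock : ∀ e ∈ S \ T, u ∈ (e : Sym2 V) → c e = s := by
    intro e he hu
    by_contra hce
    have hce' : c e = -s := by
      rcases hc e with h | h <;> rcases hs with h' | h' <;> omega
    rw [mem_sdiff] at he
    have hlt := hmax (insert e T) ⟨insert_subset he.1 hTS, ?_⟩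
    · rw [card_insert_of_notMem he.2] at hlt
      omega
    obtain ⟨w, hw⟩ := Sym2.mem_iff_exists.1 hu
    have huw : u ≠ w := by
      have := G.not_isDiag_of_mem_edgeSet e.2
      rw [hw] at this
      simpa using this
    refine ⟨w, -s, by omega, fun x => ?_⟩
    have hins : incidentSum c (insert e T) x =
        (if x ∈ (e : Sym2 V) then c e else 0) + incidentSum c T x :=
      Finset.sum_insert he.2
    rw [hins, hx, hw, hce']
    simp only [Sym2.mem_iff]
    split_ifs <;> grind
  have hsu : 0 ≤ s * incidentSum c (S \ T) u := by
    rw [incidentSum, Finset.mul_sum]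
    refine Finset.sum_nonneg fun e he => ?_
    split_ifs with h
    · rw [hblock e he h]; exact mul_self_nonneg s
    · simp
  have hadd := incidentSum_add_sdiff c hTS
  have hsum := sum_incidentSum c T
  simp only [hx, Finset.sum_add_distrib, Finset.sum_ite_eq', mem_univ, if_true] at hsum
  have hne' : s = -1 → u ≠ v := by
    rintro rfl rfl
    have := hadd u
    have := hx u
    simp only [if_true] at this
    omega
  refine ⟨T, hTS, ?_, fun x => ?_, by omega⟩
  · rw [Finset.nonempty_iff_ne_empty]
    rintro rfl
    have h0 := hx v
    simp only [incidentSum, sum_empty, if_true] at h0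
    split_ifs at h0 with h
    · exact hne' (by omega) h.symm
    · omega
  · have h1 := hadd x
    have h2 := hx x
    have h3 := hadd u
    have h4 := hx u
    by_cases hxu : x = u
    · subst hxu
      rcases hs with rfl | rfl
      · left
        split_ifs at h2 <;> simp at * <;> omega
      · right
        have := hne' rfl
        simp [this] at *
        omega
    · by_cases hxv : x = v
      · subst hxv
        simp [hxu] at h2
        omega
      · simp [hxu, hxv] at h2
        omega

lemma exists_conformal_sum_eq_one [Fintype V] (c : G.edgeSet → ℤ)
    (hc : ∀ e, c e = 1 ∨ c e = -1) (S : Finset G.edgeSet) (hS : 0 < ∑ e ∈ S, c e) :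
    ∃ T ⊆ S,
      (∀ x, 0 ≤ incidentSum c T x ∧ incidentSum c T x ≤ incidentSum c S x ∨
        incidentSum c S x ≤ incidentSum c T x ∧ incidentSum c T x ≤ 0) ∧
      ∑ e ∈ T, c e = 1 := by
  induction S using Finset.strongInduction with
  | H S ih =>
    obtain ⟨v, -, hv⟩ : ∃ v ∈ univ, 0 < incidentSum c S v := by
      by_contra! h
      have := Finset.sum_nonpos h
      rw [sum_incidentSum] at this
      omega
    obtain ⟨T, hTS, hne, hconf, h1 | h0⟩ := exists_conformal_trail c hc S v hv
    · exact ⟨T, hTS, hconf, h1⟩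
    · have hsd := Finset.sum_sdiff (f := c) hTS
      obtain ⟨T', hT', hconf', h1⟩ := ih (S \ T) (sdiff_ssubset hTS hne) (by omega)
      refine ⟨T', hT'.trans sdiff_subset, fun x => ?_, h1⟩
      have := hconf x
      have := hconf' x
      have := incidentSum_add_sdiff c hTS x
      omega

/-- The weight `1` on the edges in `A` and `-1` on the other edges. -/
def cutSign (A : Finset G.edgeSet) (e : G.edgeSet) : ℤ := if e ∈ A then 1 else -1

lemma cutSize_lineGraph [Fintype V] [DecidableRel G.Adj] (A : Finset G.edgeSet) :
    (cutSize G.lineGraph A : ℤ) =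
      ∑ v, incidentSum (fun _ => 1) A v * incidentSum (fun _ => 1) Aᶜ v := by
  have hpair : ∀ e f : G.edgeSet, e ≠ f →
      ((if G.lineGraph.Adj e f then 1 else 0 : ℤ)) =
      ∑ v, (if v ∈ (e : Sym2 V) then 1 else 0) * (if v ∈ (f : Sym2 V) then 1 else 0) := by
    intro e f hef
    have hadj : G.lineGraph.Adj e f ↔ ∃ v, v ∈ (e : Sym2 V) ∧ v ∈ (f : Sym2 V) := by
      rw [SimpleGraph.lineGraph_adj_iff_exists]
      simp [hef]
    simp only [hadj, ← ite_and, mul_ite, mul_one, mul_zero]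
    by_cases h : ∃ v, v ∈ (e : Sym2 V) ∧ v ∈ (f : Sym2 V)
    · obtain ⟨v, hve, hvf⟩ := h
      rw [if_pos ⟨v, hve, hvf⟩, Finset.sum_eq_single v]
      · simp [hve, hvf]
      · intro w _ hw
        rw [if_neg]
        rintro ⟨hwf, hwe⟩
        exact hef (Subtype.ext (Sym2.eq_of_ne_mem hw hwe hve hwf hvf))
      · simp
    · rw [if_neg h, eq_comm]
      refine Finset.sum_eq_zero fun v _ => if_neg fun hv => h ⟨v, hv.2, hv.1⟩
  have hfilter : (univ.filter fun p : G.edgeSet × G.edgeSet =>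
      G.lineGraph.Adj p.1 p.2 ∧ p.1 ∈ A ∧ p.2 ∉ A) =
      (A ×ˢ Aᶜ).filter fun p => G.lineGraph.Adj p.1 p.2 := by
    ext p; simp [and_comm]
  rw [cutSize, hfilter, Finset.card_filter]
  push_cast
  rw [Finset.sum_product]
  simp only [incidentSum, Finset.sum_mul_sum]
  symm
  rw [Finset.sum_comm]
  refine Finset.sum_congr rfl fun e he => ?_
  rw [Finset.sum_comm]
  refine Finset.sum_congr rfl fun f hf => (hpair e f ?_).symm
  rintro rfl
  exact (mem_compl.1 hf) he

lemma four_mul_cutSize_lineGraph [Fintype V] [DecidableRel G.Adj] (A : Finset G.edgeSet) :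
    4 * (cutSize G.lineGraph A : ℤ) =
      ∑ v, (incidentSum (fun _ => 1) (univ : Finset G.edgeSet) v ^ 2 -
        incidentSum (cutSign A) univ v ^ 2) := by
  rw [cutSize_lineGraph, Finset.mul_sum]
  refine Finset.sum_congr rfl fun v _ => ?_
  have h1 : incidentSum (fun _ => 1) (univ : Finset G.edgeSet) v =
      incidentSum (fun _ => 1) A v + incidentSum (fun _ => 1) Aᶜ v :=
    (Finset.sum_add_sum_compl A _).symm
  have h2 : incidentSum (cutSign A) univ v =
      incidentSum (fun _ => 1) A v - incidentSum (fun _ => 1) Aᶜ v := by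
    rw [incidentSum, ← Finset.sum_add_sum_compl A, sub_eq_add_neg, incidentSum, incidentSum,
      ← Finset.sum_neg_distrib]
    congr 1 <;> refine Finset.sum_congr rfl fun e he => ?_
    · simp [cutSign, he]
    · rw [mem_compl] at he
      split_ifs <;> simp [cutSign, he]
  rw [h1, h2]
  ring

lemma sum_cutSign [Fintype V] [DecidableRel G.Adj] (A : Finset G.edgeSet) :
    ∑ e, cutSign A e = (A.card : ℤ) - (Aᶜ.card : ℤ) := by
  rw [← Finset.sum_add_sum_compl A, Finset.sum_congr rfl (g := fun _ => (1 : ℤ)),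
    Finset.sum_congr (s₁ := Aᶜ) rfl (g := fun _ => (-1 : ℤ))]
  · simp [sub_eq_add_neg]
  · intro e he
    simp [cutSign, mem_compl.1 he]
  · intro e he
    simp [cutSign, he]

lemma cutSize_lineGraph_compl [Fintype V] [DecidableRel G.Adj] (A : Finset G.edgeSet) :
    cutSize G.lineGraph Aᶜ = cutSize G.lineGraph A := by
  zify
  rw [cutSize_lineGraph, cutSize_lineGraph, compl_compl]
  simp only [mul_comm]

/-- If `A` has at least two more edges than its complement, then one can make the two sides more
balanced without decreasing the size of the cut. -/
lemma exists_cutSize_le_of_two_le [Fintype V] [DecidableRel G.Adj] (A : Finset G.edgeSet)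
    (hA : 2 ≤ ∑ e, cutSign A e) :
    ∃ B : Finset G.edgeSet, cutSize G.lineGraph A ≤ cutSize G.lineGraph B ∧
      ∑ e, cutSign B e = ∑ e, cutSign A e - 2 := by
  obtain ⟨T, -, hconf, h1⟩ := exists_conformal_sum_eq_one (cutSign A)
    (fun e => by unfold cutSign; split_ifs <;> simp) univ (by omega)
  have hsign : ∀ e, cutSign (symmDiff A T) e =
      cutSign A e - 2 * if e ∈ T then cutSign A e else 0 := by
    intro e
    simp only [cutSign, mem_symmDiff]
    by_cases ha : e ∈ A <;> by_cases ht : e ∈ T <;> simp [ha, ht]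
  have hinc : ∀ v, incidentSum (cutSign (symmDiff A T)) univ v =
      incidentSum (cutSign A) univ v - 2 * incidentSum (cutSign A) T v := by
    intro v
    have hT : incidentSum (cutSign A) T v =
        ∑ e, if e ∈ T then (if v ∈ (e : Sym2 V) then cutSign A e else 0) else 0 := by
      simp [incidentSum]
    rw [hT, incidentSum, incidentSum, Finset.mul_sum, ← Finset.sum_sub_distrib]
    refine Finset.sum_congr rfl fun e _ => ?_
    rw [hsign]
    split_ifs <;> simp
  refine ⟨symmDiff A T, ?_, ?_⟩
  · zify
    refine le_of_mul_le_mul_left (a := (4 : ℤ)) ?_ (by norm_num)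
    rw [four_mul_cutSize_lineGraph, four_mul_cutSize_lineGraph]
    refine Finset.sum_le_sum fun v _ => ?_
    rw [hinc]
    rcases hconf v with ⟨h, h'⟩ | ⟨h', h⟩ <;> nlinarith
  · simp only [hsign, Finset.sum_sub_distrib, ← Finset.mul_sum]
    simp [h1]

end

/-- Every line graph admits a bisection that is at the same time a maximum cut:
its size is at least the size of every cut of the line graph.  In particular, the maximum
size of a bisection of `L(G)` equals the maximum size of a cut of `L(G)`. -/
theorem lineGraph_exists_bisection_maxcut
    {V : Type*} [Fintype V] [DecidableEq V] (G : SimpleGraph V) [DecidableRel G.Adj] :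
    ∃ A : Finset G.edgeSet, IsBisection A ∧
      ∀ D : Finset G.edgeSet, cutSize G.lineGraph D ≤ cutSize G.lineGraph A := by
  obtain ⟨M, -, hM⟩ := Finset.exists_max_image (univ : Finset (Finset G.edgeSet))
    (fun A => cutSize G.lineGraph A) univ_nonempty
  obtain ⟨A, hA, hmin⟩ := Finset.exists_min_image
    (univ.filter fun A : Finset G.edgeSet => cutSize G.lineGraph M ≤ cutSize G.lineGraph A)
    (fun A => (∑ e, cutSign A e).natAbs) ⟨M, by simp⟩
  simp only [mem_filter, mem_univ, true_and, true_implies] at hA hmin hM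
  refine ⟨A, ?_, fun D => (hM D).trans hA⟩
  rw [IsBisection, ← sum_cutSign]
  by_contra h
  rcases le_or_gt 2 (∑ e, cutSign A e) with h2 | h2
  · obtain ⟨B, hB, hs⟩ := exists_cutSize_le_of_two_le A h2
    have := hmin B (hA.trans hB)
    omega
  · have hc : ∑ e, cutSign Aᶜ e = -∑ e, cutSign A e := by
      rw [sum_cutSign, sum_cutSign, compl_compl]
      ring
    obtain ⟨B, hB, hs⟩ := exists_cutSize_le_of_two_le Aᶜ (by omega)
    rw [cutSize_lineGraph_compl] at hB
    have := hmin B (hA.trans hB)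
    omega
end

section
/- Let n ≥ 1 and let (a_i)_{1≤i≤n}, (b_i)_{1≤i≤n}, (c_i)_{1≤i≤2n} be integer sequences, let M be the maximum absolute value occurring among them, and let W = 4nM + 1. Let P be the edge-weighted path on 224n vertices constructed as follows. P consists (in order along the path) of: a subpath Q_1 with 100n vertices, all of whose 100n-1 edges have weight 3W+1; an edge of weight 3W+1 joining the last vertex t_1 of Q_1 to x_1; a subpath P_a = (x_1, ..., x_{n+1}) where edge {x_i, x_{i+1}} has weight a_i + W; a subpath Q_2 with 55n vertices whose first vertex is identified with x_{n+1} and all of whose 55n-1 edges have weight 3W+1, and whose last vertex is identified with y_{n+1}; a subpath P_b traversed as (y_{n+1}, y_n, ..., y_1) where edge {y_i, y_{i+1}} has weight b_i + W; an edge of weight 3W+1 joining y_1 to the first vertex s_3 of a subpath Q_3 with 10n vertices, all of whose 10n-1 edges have weight 3W+1, whose last vertex is identified with z_{2n+1}; a subpath P_c traversed as (z_{2n+1}, z_{2n}, ..., z_1) where edge {z_i, z_{i+1}} has weight c_i + W; and an edge of weight 3W+1 joining z_1 to the first vertex s_4 of a subpath Q_4 with 55n vertices, all of whose 55n-1 edges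 have weight 3W+1. Then P has a bisection of size at most 3W if and only if there exist indices i, j with 1 ≤ i, j ≤ n such that a_i + b_j + c_{i+j} ≤ 0. -/
/-- The weight of the `i`-th edge (joining vertices `i` and `i + 1`, `0`-indexed) of the
path `P` on `224 * n` vertices built from `Q₁` (vertices `0, …, 100n - 1`), a connector
edge, `P_a = (x_1, …, x_{n+1})` (vertices `100n, …, 101n`), `Q₂` (vertices
`101n, …, 156n - 1`, with first vertex `x_{n+1}` and last vertex `y_{n+1}`), `P_b`
traversed as `(y_{n+1}, …, y_1)` (so `y_j` is vertex `157n - j`), a connector edge, `Q₃`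
(vertices `157n, …, 167n - 1`, whose last vertex is `z_{2n+1}`), `P_c` traversed as
`(z_{2n+1}, …, z_1)` (so `z_j` is vertex `169n - j`), a connector edge, and `Q₄`
(vertices `169n, …, 224n - 1`).  All `Q`-edges and connector edges have weight `3W + 1`;
the edge `{x_i, x_{i+1}}` has weight `a_i + W`, the edge `{y_i, y_{i+1}}` has weight
`b_i + W`, and the edge `{z_i, z_{i+1}}` has weight `c_i + W`. -/
def pathWeight (n : ℕ) (a b c : ℕ → ℤ) (W : ℤ) (i : ℕ) : ℤ :=
  if i < 100 * n then 3 * W + 1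
  else if i < 101 * n then a (i - 100 * n + 1) + W
  else if i < 156 * n - 1 then 3 * W + 1
  else if i < 157 * n - 1 then b (157 * n - 1 - i) + W
  else if i < 167 * n - 1 then 3 * W + 1
  else if i < 169 * n - 1 then c (169 * n - 1 - i) + W
  else 3 * W + 1

/-- The size of the cut `(A, Aᶜ)` of the weighted path `P` on `224 * n` vertices whose
`i`-th edge joins vertices `i` and `i + 1` and has weight `pathWeight n a b c W i`:
the total weight of the edges with exactly one endpoint in `A`. -/
def pathCutSize (n : ℕ) (a b c : ℕ → ℤ) (W : ℤ) (A : Finset (Fin (224 * n))) : ℤ :=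
  ∑ i : Fin (224 * n - 1),
    if ((⟨i.1, by have h := i.2; omega⟩ : Fin (224 * n)) ∈ A ∧
          (⟨i.1 + 1, by have h := i.2; omega⟩ : Fin (224 * n)) ∉ A) ∨
        ((⟨i.1, by have h := i.2; omega⟩ : Fin (224 * n)) ∉ A ∧
          (⟨i.1 + 1, by have h := i.2; omega⟩ : Fin (224 * n)) ∈ A)
    then pathWeight n a b c W i.1 else 0

theorem eq_of_no_change {s : ℕ → ℤ} {l r : ℕ} (hlr : l ≤ r)
    (h : ∀ i, l ≤ i → i < r → s i = s (i + 1)) : s r = s l := by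
  induction r, hlr using Nat.le_induction with
  | base => rfl
  | succ r hr ih =>
    rw [← h r hr (by omega)]
    exact ih fun i hi hir => h i hi (by omega)

theorem sum_Ico_of_no_change {s : ℕ → ℤ} {l r : ℕ} (hlr : l ≤ r)
    (h : ∀ i, l ≤ i → i + 1 < r → s i = s (i + 1)) :
    ∑ i ∈ Finset.Ico l r, s i = ((r : ℤ) - l) * s l := by
  rw [Finset.sum_congr rfl (g := fun _ => s l)]
  · simp [Nat.cast_sub hlr]
  · intro i hi
    rw [Finset.mem_Ico] at hi
    exact eq_of_no_change hi.1 fun j hj hji => h j hj (by omega)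

theorem abs_sum_Ico_le {s : ℕ → ℤ} (hs : ∀ i, s i = 1 ∨ s i = -1) {l r : ℕ} (hlr : l ≤ r) :
    |∑ i ∈ Finset.Ico l r, s i| ≤ (r : ℤ) - l := by
  calc |∑ i ∈ Finset.Ico l r, s i| ≤ ∑ i ∈ Finset.Ico l r, |s i| :=
        Finset.abs_sum_le_sum_abs _ _
    _ = ∑ i ∈ Finset.Ico l r, 1 :=
        Finset.sum_congr rfl fun i _ => by rcases hs i with h | h <;> simp [h]
    _ = (r : ℤ) - l := by simp [Nat.cast_sub hlr]

theorem exists_change {s : ℕ → ℤ} {l r : ℕ} (hlr : l ≤ r) (h : s r ≠ s l) :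
    ∃ i, l ≤ i ∧ i < r ∧ s i ≠ s (i + 1) := by
  by_contra! hc
  exact h (eq_of_no_change hlr hc)

/-- The sum of a sequence which changes value at most after the positions `p`, `q`, `r`. -/
theorem sum_range_of_three_changes {s : ℕ → ℤ} {p q r N : ℕ} (hpq : p < q) (hqr : q < r)
    (hrN : r < N) (h : ∀ i, i + 1 < N → i ≠ p → i ≠ q → i ≠ r → s i = s (i + 1)) :
    ∑ i ∈ Finset.range N, s i = ((p : ℤ) + 1) * s 0 + ((q : ℤ) - p) * s (p + 1) +
      ((r : ℤ) - q) * s (q + 1) + ((N : ℤ) - (r + 1)) * s (r + 1) := by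
  have h1 := sum_Ico_of_no_change (s := s) (l := 0) (r := p + 1) (by omega)
    fun i _ _ => h i (by omega) (by omega) (by omega) (by omega)
  have h2 := sum_Ico_of_no_change (s := s) (l := p + 1) (r := q + 1) (by omega)
    fun i _ _ => h i (by omega) (by omega) (by omega) (by omega)
  have h3 := sum_Ico_of_no_change (s := s) (l := q + 1) (r := r + 1) (by omega)
    fun i _ _ => h i (by omega) (by omega) (by omega) (by omega)
  have h4 := sum_Ico_of_no_change (s := s) (l := r + 1) (r := N) (by omega)
    fun i _ _ => h i (by omega) (by omega) (by omega) (by omega)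
  rw [Finset.range_eq_Ico,
    ← Finset.sum_Ico_consecutive s (Nat.zero_le (p + 1)) (by omega : p + 1 ≤ N),
    ← Finset.sum_Ico_consecutive s (by omega : p + 1 ≤ q + 1) (by omega : q + 1 ≤ N),
    ← Finset.sum_Ico_consecutive s (by omega : q + 1 ≤ r + 1) (by omega : r + 1 ≤ N),
    h1, h2, h3, h4]
  push_cast
  ring

/-- The `±1`-valued indicator of `A`, extended by `-1` to all naturals. -/
def sideSign {N : ℕ} (A : Finset (Fin N)) (i : ℕ) : ℤ :=
  if ∃ h : i < N, (⟨i, h⟩ : Fin N) ∈ A then 1 else -1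

theorem sideSign_eq {N : ℕ} (A : Finset (Fin N)) (i : ℕ) :
    sideSign A i = 1 ∨ sideSign A i = -1 := by
  unfold sideSign
  split_ifs <;> simp

theorem sum_sideSign {N : ℕ} (A : Finset (Fin N)) :
    ∑ i ∈ Finset.range N, sideSign A i = (A.card : ℤ) - (Aᶜ.card : ℤ) := by
  rw [Finset.sum_range, ← Finset.sum_add_sum_compl A,
    Finset.sum_congr rfl (g := fun _ => (1 : ℤ)) fun i hi => by simp [sideSign, hi],
    Finset.sum_congr (s₁ := Aᶜ) rfl (g := fun _ => (-1 : ℤ)) fun i hi => by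
      rw [Finset.mem_compl] at hi
      simp [sideSign, hi]]
  simp [sub_eq_add_neg]

theorem isBisection_iff_sum_sideSign {m : ℕ} (A : Finset (Fin (224 * m))) :
    IsBisection A ↔ ∑ i ∈ Finset.range (224 * m), sideSign A i = 0 := by
  have h := Finset.card_add_card_compl A
  rw [Fintype.card_fin] at h
  rw [sum_sideSign, IsBisection]
  omega

theorem pathCutSize_eq (n : ℕ) (a b c : ℕ → ℤ) (W : ℤ) (A : Finset (Fin (224 * n))) :
    pathCutSize n a b c W A = ∑ i ∈ Finset.range (224 * n - 1),
      if sideSign A i ≠ sideSign A (i + 1) then pathWeight n a b c W i else 0 := by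
  rw [Finset.sum_range, pathCutSize]
  refine Finset.sum_congr rfl fun i _ => if_congr ?_ rfl rfl
  have h1 : i.1 < 224 * n := by omega
  have h2 : i.1 + 1 < 224 * n := by omega
  by_cases hA : (⟨i.1, h1⟩ : Fin (224 * n)) ∈ A <;>
    by_cases hB : (⟨i.1 + 1, h2⟩ : Fin (224 * n)) ∈ A <;>
    simp [sideSign, hA, hB, h1, h2]

theorem sum_le_cutSum {s w : ℕ → ℤ} {N : ℕ} (hw : ∀ i ∈ Finset.range N, 0 ≤ w i)
    {t : Finset ℕ} (ht : ∀ i ∈ t, i < N ∧ s i ≠ s (i + 1)) :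
    ∑ i ∈ t, w i ≤ ∑ i ∈ Finset.range N, if s i ≠ s (i + 1) then w i else 0 := by
  rw [← Finset.sum_filter]
  refine Finset.sum_le_sum_of_subset_of_nonneg (fun i hi => ?_) fun i hi _ => ?_
  · simpa using ht i hi
  · exact hw i (Finset.mem_filter.mp hi).1

section Weights

variable {n : ℕ} {a b c : ℕ → ℤ} {M W : ℤ}

theorem pathWeight_a {i : ℕ} (h1 : 1 ≤ i) (h2 : i ≤ n) :
    pathWeight n a b c W (100 * n + i - 1) = a i + W := by
  unfold pathWeight
  rw [if_neg (by omega), if_pos (by omega)]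
  congr 2
  omega

theorem pathWeight_b {j : ℕ} (h1 : 1 ≤ j) (h2 : j ≤ n) :
    pathWeight n a b c W (157 * n - 1 - j) = b j + W := by
  unfold pathWeight
  rw [if_neg (by omega), if_neg (by omega), if_neg (by omega), if_pos (by omega)]
  congr 2
  omega

theorem pathWeight_c {k : ℕ} (h1 : 1 ≤ k) (h2 : k ≤ 2 * n) :
    pathWeight n a b c W (169 * n - 1 - k) = c k + W := by
  unfold pathWeight
  rw [if_neg (by omega), if_neg (by omega), if_neg (by omega), if_neg (by omega),
    if_neg (by omega), if_pos (by omega)]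
  congr 2
  omega

theorem pathWeight_heavy {i : ℕ} (h : i < 100 * n ∨ (101 * n ≤ i ∧ i < 156 * n - 1) ∨
    (157 * n - 1 ≤ i ∧ i < 167 * n - 1) ∨ 169 * n - 1 ≤ i) :
    pathWeight n a b c W i = 3 * W + 1 := by
  unfold pathWeight
  split_ifs <;> first | rfl | omega

theorem sub_le_pathWeight (hM : 0 ≤ M) (hW : 0 ≤ W)
    (ha : ∀ i, 1 ≤ i → i ≤ n → |a i| ≤ M) (hb : ∀ i, 1 ≤ i → i ≤ n → |b i| ≤ M)
    (hc : ∀ i, 1 ≤ i → i ≤ 2 * n → |c i| ≤ M) (i : ℕ) :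
    W - M ≤ pathWeight n a b c W i := by
  unfold pathWeight
  split_ifs
  · omega
  · have := (abs_le.mp (ha (i - 100 * n + 1) (by omega) (by omega))).1
    omega
  · omega
  · have := (abs_le.mp (hb (157 * n - 1 - i) (by omega) (by omega))).1
    omega
  · omega
  · have := (abs_le.mp (hc (169 * n - 1 - i) (by omega) (by omega))).1
    omega
  · omega

end Weights

/-- A balanced sign sequence that is constant on each of the four heavy segments changes in each
of the three light segments. -/
theorem exists_three_changes {n : ℕ} (hn : 1 ≤ n) {s : ℕ → ℤ} (hs : ∀ i, s i = 1 ∨ s i = -1)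
    (hsum : ∑ i ∈ Finset.range (224 * n), s i = 0)
    (h : ∀ i, i + 1 < 224 * n → (i < 100 * n ∨ (101 * n ≤ i ∧ i < 156 * n - 1) ∨
      (157 * n - 1 ≤ i ∧ i < 167 * n - 1) ∨ 169 * n - 1 ≤ i) → s i = s (i + 1)) :
    (∃ p, 100 * n ≤ p ∧ p < 101 * n ∧ s p ≠ s (p + 1)) ∧
    (∃ q, 156 * n - 1 ≤ q ∧ q < 157 * n - 1 ∧ s q ≠ s (q + 1)) ∧
    (∃ r, 167 * n - 1 ≤ r ∧ r < 169 * n - 1 ∧ s r ≠ s (r + 1)) := by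
  have h1 := sum_Ico_of_no_change (s := s) (l := 0) (r := 100 * n + 1) (by omega)
    fun i _ _ => h i (by omega) (by omega)
  have h3 := sum_Ico_of_no_change (s := s) (l := 101 * n) (r := 156 * n) (by omega)
    fun i _ _ => h i (by omega) (by omega)
  have h5 := sum_Ico_of_no_change (s := s) (l := 157 * n - 1) (r := 167 * n) (by omega)
    fun i _ _ => h i (by omega) (by omega)
  have h7 := sum_Ico_of_no_change (s := s) (l := 169 * n - 1) (r := 224 * n) (by omega)
    fun i _ _ => h i (by omega) (by omega)
  have h2 := abs_le.mp (abs_sum_Ico_le hs (by omega : 100 * n + 1 ≤ 101 * n))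
  have h4 := abs_le.mp (abs_sum_Ico_le hs (by omega : 156 * n ≤ 157 * n - 1))
  have h6 := abs_le.mp (abs_sum_Ico_le hs (by omega : 167 * n ≤ 169 * n - 1))
  have e1 : s (100 * n) = s 0 :=
    eq_of_no_change (by omega) fun i _ _ => h i (by omega) (by omega)
  have e2 : s (156 * n - 1) = s (101 * n) :=
    eq_of_no_change (by omega) fun i _ _ => h i (by omega) (by omega)
  have e3 : s (167 * n - 1) = s (157 * n - 1) :=
    eq_of_no_change (by omega) fun i _ _ => h i (by omega) (by omega)
  rw [Finset.range_eq_Ico,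
    ← Finset.sum_Ico_consecutive s (by omega : 0 ≤ 100 * n + 1) (by omega),
    ← Finset.sum_Ico_consecutive s (by omega : 100 * n + 1 ≤ 101 * n) (by omega),
    ← Finset.sum_Ico_consecutive s (by omega : 101 * n ≤ 156 * n) (by omega),
    ← Finset.sum_Ico_consecutive s (by omega : 156 * n ≤ 157 * n - 1) (by omega),
    ← Finset.sum_Ico_consecutive s (by omega : 157 * n - 1 ≤ 167 * n) (by omega),
    ← Finset.sum_Ico_consecutive s (by omega : 167 * n ≤ 169 * n - 1) (by omega),
    h1, h3, h5, h7] at hsum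
  have key : s (101 * n) ≠ s (100 * n) ∧ s (157 * n - 1) ≠ s (156 * n - 1) ∧
      s (169 * n - 1) ≠ s (167 * n - 1) := by
    rw [e1, e2, e3]
    rcases hs 0 with k1 | k1 <;> rcases hs (101 * n) with k2 | k2 <;>
      rcases hs (157 * n - 1) with k3 | k3 <;> rcases hs (169 * n - 1) with k4 | k4 <;>
      rw [k1, k2, k3, k4] at hsum <;> rw [k1, k2, k3, k4] <;> first | decide | omega
  exact ⟨exists_change (by omega) key.1, exists_change (by omega) key.2.1,
    exists_change (by omega) key.2.2⟩

theorem exists_indices_of_bisection {n : ℕ} (hn : 1 ≤ n) {a b c : ℕ → ℤ} {W M : ℤ} (hM : 0 ≤ M)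
    (hW : 4 * M < W) (hw : ∀ i, W - M ≤ pathWeight n a b c W i) {s : ℕ → ℤ}
    (hs : ∀ i, s i = 1 ∨ s i = -1) (hsum : ∑ i ∈ Finset.range (224 * n), s i = 0)
    (hcut : (∑ i ∈ Finset.range (224 * n - 1),
      if s i ≠ s (i + 1) then pathWeight n a b c W i else 0) ≤ 3 * W) :
    ∃ i j : ℕ, 1 ≤ i ∧ i ≤ n ∧ 1 ≤ j ∧ j ≤ n ∧ a i + b j + c (i + j) ≤ 0 := by
  have hw0 : ∀ i ∈ Finset.range (224 * n - 1), 0 ≤ pathWeight n a b c W i := fun i _ => by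
    linarith [hw i]
  obtain ⟨⟨p, hp1, hp2, hp⟩, ⟨q, hq1, hq2, hq⟩, ⟨r, hr1, hr2, hr⟩⟩ :=
    exists_three_changes hn hs hsum fun i hi hheavy => by
      by_contra hne
      have := sum_le_cutSum (s := s) hw0 (t := {i}) (by
        intro k hk
        rw [Finset.mem_singleton] at hk
        subst hk
        exact ⟨by omega, hne⟩)
      rw [Finset.sum_singleton, pathWeight_heavy hheavy] at this
      omega
  have hother : ∀ i, i + 1 < 224 * n → i ≠ p → i ≠ q → i ≠ r → s i = s (i + 1) := by
    intro i hi hip hiq hir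
    by_contra hne
    have := sum_le_cutSum (s := s) hw0 (t := {i, p, q, r}) (by
      intro k hk
      simp only [Finset.mem_insert, Finset.mem_singleton] at hk
      rcases hk with rfl | rfl | rfl | rfl
      · exact ⟨by omega, hne⟩
      · exact ⟨by omega, hp⟩
      · exact ⟨by omega, hq⟩
      · exact ⟨by omega, hr⟩)
    rw [Finset.sum_insert (by simp; omega), Finset.sum_insert (by simp; omega),
      Finset.sum_insert (by simp; omega), Finset.sum_singleton] at this
    linarith [hw i, hw p, hw q, hw r]
  have hthree := sum_le_cutSum (s := s) hw0 (t := {p, q, r}) (by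
    intro k hk
    simp only [Finset.mem_insert, Finset.mem_singleton] at hk
    rcases hk with rfl | rfl | rfl
    · exact ⟨by omega, hp⟩
    · exact ⟨by omega, hq⟩
    · exact ⟨by omega, hr⟩)
  rw [Finset.sum_insert (by simp; omega), Finset.sum_insert (by simp; omega),
    Finset.sum_singleton] at hthree
  rw [sum_range_of_three_changes (by omega) (by omega) (by omega : r < 224 * n) hother] at hsum
  have e1 : s p = s 0 := eq_of_no_change (by omega) fun i _ _ =>
    hother i (by omega) (by omega) (by omega) (by omega)
  have e2 : s q = s (p + 1) := eq_of_no_change (by omega) fun i _ _ =>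
    hother i (by omega) (by omega) (by omega) (by omega)
  have e3 : s r = s (q + 1) := eq_of_no_change (by omega) fun i _ _ =>
    hother i (by omega) (by omega) (by omega) (by omega)
  rw [e1] at hp
  rw [e2] at hq
  rw [e3] at hr
  have hbal : p + r + 1 = 112 * n + q := by
    rcases hs 0 with k1 | k1 <;> rcases hs (p + 1) with k2 | k2 <;>
      rcases hs (q + 1) with k3 | k3 <;> rcases hs (r + 1) with k4 | k4 <;>
      rw [k1, k2, k3, k4] at hsum <;> omega
  obtain ⟨i, rfl⟩ : ∃ i, p = 100 * n + i - 1 := ⟨p + 1 - 100 * n, by omega⟩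
  obtain ⟨j, rfl⟩ : ∃ j, q = 157 * n - 1 - j := ⟨157 * n - 1 - q, by omega⟩
  obtain rfl : r = 169 * n - 1 - (i + j) := by omega
  refine ⟨i, j, by omega, by omega, by omega, by omega, ?_⟩
  rw [pathWeight_a (by omega) (by omega), pathWeight_b (by omega) (by omega),
    pathWeight_c (by omega) (by omega)] at hthree
  omega

theorem exists_bisection_of_indices {n : ℕ} {a b c : ℕ → ℤ} {W : ℤ} {i j : ℕ} (hi1 : 1 ≤ i)
    (hi2 : i ≤ n) (hj1 : 1 ≤ j) (hj2 : j ≤ n) :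
    ∃ A : Finset (Fin (224 * n)), IsBisection A ∧
      pathCutSize n a b c W A = 3 * W + (a i + b j + c (i + j)) := by
  obtain ⟨p, hp⟩ : ∃ p, p = 100 * n + i - 1 := ⟨_, rfl⟩
  obtain ⟨q, hq⟩ : ∃ q, q = 157 * n - 1 - j := ⟨_, rfl⟩
  obtain ⟨r, hr⟩ : ∃ r, r = 169 * n - 1 - (i + j) := ⟨_, rfl⟩
  let A : Finset (Fin (224 * n)) := {v | v.1 ≤ p ∨ (q < v.1 ∧ v.1 ≤ r)}
  have hs : ∀ k, sideSign A k = if k ≤ p ∨ (q < k ∧ k ≤ r) then 1 else -1 := by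
    intro k
    refine if_congr ?_ rfl rfl
    simp only [A, Finset.mem_filter, Finset.mem_univ, true_and, exists_prop]
    omega
  have hchange : ∀ k, sideSign A k ≠ sideSign A (k + 1) ↔ k = p ∨ k = q ∨ k = r := by
    intro k
    rw [hs, hs]
    split_ifs <;> simp <;> omega
  refine ⟨A, ?_, ?_⟩
  · rw [isBisection_iff_sum_sideSign, sum_range_of_three_changes (p := p) (q := q) (r := r)
      (by omega) (by omega) (by omega) fun k _ h1 h2 h3 => by
        by_contra hne
        have := (hchange k).mp hne
        omega]
    rw [hs, hs, hs, hs, if_pos (by omega), if_neg (by omega), if_pos (by omega),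
      if_neg (by omega)]
    omega
  · have hfilter : (Finset.range (224 * n - 1)).filter
        (fun k => sideSign A k ≠ sideSign A (k + 1)) = {p, q, r} := by
      ext k
      rw [Finset.mem_filter, hchange]
      simp only [Finset.mem_range, Finset.mem_insert, Finset.mem_singleton]
      omega
    rw [pathCutSize_eq, ← Finset.sum_filter, hfilter, Finset.sum_insert (by simp; omega),
      Finset.sum_insert (by simp; omega), Finset.sum_singleton, hp, hq, hr,
      pathWeight_a hi1 hi2, pathWeight_b hj1 hj2, pathWeight_c (by omega) (by omega)]
    ring

/-- Let `n ≥ 1`, let `(a_i)_{1 ≤ i ≤ n}`, `(b_i)_{1 ≤ i ≤ n}`, `(c_i)_{1 ≤ i ≤ 2n}` be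
integer sequences with maximum absolute value `M`, and let `W = 4nM + 1`.  The weighted
path `P` on `224n` vertices described above has a bisection of size at most `3W` iff
there are indices `1 ≤ i, j ≤ n` with `a_i + b_j + c_{i+j} ≤ 0`. -/
theorem minBisection_path_iff_threeSum
    (n : ℕ) (hn : 1 ≤ n) (a b c : ℕ → ℤ) (M W : ℤ)
    (hM : M = max ((Finset.Icc 1 n).sup' (Finset.nonempty_Icc.mpr hn) fun i => |a i|)
      (max ((Finset.Icc 1 n).sup' (Finset.nonempty_Icc.mpr hn) fun i => |b i|)
        ((Finset.Icc 1 (2 * n)).sup' (Finset.nonempty_Icc.mpr (by omega)) fun i => |c i|)))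
    (hW : W = 4 * n * M + 1) :
    (∃ A : Finset (Fin (224 * n)), IsBisection A ∧ pathCutSize n a b c W A ≤ 3 * W) ↔
      (∃ i j : ℕ, 1 ≤ i ∧ i ≤ n ∧ 1 ≤ j ∧ j ≤ n ∧ a i + b j + c (i + j) ≤ 0) := by
  have ha : ∀ i, 1 ≤ i → i ≤ n → |a i| ≤ M := fun i h1 h2 => by
    rw [hM]
    exact le_max_of_le_left
      (Finset.le_sup' (fun i => |a i|) (Finset.mem_Icc.mpr ⟨h1, h2⟩))
  have hb : ∀ i, 1 ≤ i → i ≤ n → |b i| ≤ M := fun i h1 h2 => by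
    rw [hM]
    exact le_max_of_le_right (le_max_of_le_left
      (Finset.le_sup' (fun i => |b i|) (Finset.mem_Icc.mpr ⟨h1, h2⟩)))
  have hc : ∀ i, 1 ≤ i → i ≤ 2 * n → |c i| ≤ M := fun i h1 h2 => by
    rw [hM]
    exact le_max_of_le_right (le_max_of_le_right
      (Finset.le_sup' (fun i => |c i|) (Finset.mem_Icc.mpr ⟨h1, h2⟩)))
  have hM0 : 0 ≤ M := (abs_nonneg _).trans (ha 1 le_rfl hn)
  have hn' : (1 : ℤ) ≤ n := by exact_mod_cast hn
  have hWM : 4 * M < W := by nlinarith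
  constructor
  · rintro ⟨A, hA, hcut⟩
    rw [pathCutSize_eq] at hcut
    exact exists_indices_of_bisection hn hM0 hWM
      (sub_le_pathWeight hM0 (by omega) ha hb hc) (sideSign_eq A)
      ((isBisection_iff_sum_sideSign A).mp hA) hcut
  · rintro ⟨i, j, hi1, hi2, hj1, hj2, hle⟩
    obtain ⟨A, hA, hcut⟩ :=
      exists_bisection_of_indices (a := a) (b := b) (c := c) (W := W) hi1 hi2 hj1 hj2
    exact ⟨A, hA, by omega⟩
end

section
/- Let G = (V, E) be a finite simple graph with edge weights w: E → ℝ, let C ⊆ V be a vertex cover of G, let X ⊆ C, and let (A, B) be a cut of G with A ∩ C = X (and hence B ∩ C = C \ X). Then w(A, B) = w(X, C \ X) + Σ_{v ∈ A \ C} p_v + Σ_{v ∈ V \ C} w(X, {v}), where p_v = w(C \ X, {v}) - w(X, {v}) for each v ∈ V \ C. -/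
/-- For disjoint sets `Y, Z` of vertices of the edge-weighted graph `G`, `wSum G w Y Z`
is the total weight of the edges of `G` with one endpoint in `Y` and one endpoint in `Z`
(each such edge is counted once, as the ordered pair whose first coordinate lies in `Y`). -/
def wSum {V : Type*} [Fintype V] [DecidableEq V] (G : SimpleGraph V) [DecidableRel G.Adj]
    (w : Sym2 V → ℝ) (Y Z : Finset V) : ℝ :=
  ∑ p ∈ Finset.univ.filter (fun p : V × V => G.Adj p.1 p.2 ∧ p.1 ∈ Y ∧ p.2 ∈ Z),
    w s(p.1, p.2)

section wSum

variable {V : Type*} [Fintype V] [DecidableEq V] (G : SimpleGraph V) [DecidableRel G.Adj]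
  (w : Sym2 V → ℝ)

theorem wSum_eq_sum_sum (Y Z : Finset V) :
    wSum G w Y Z = ∑ u ∈ Y, ∑ v ∈ Z, if G.Adj u v then w s(u, v) else 0 := by
  rw [wSum, ← Finset.sum_product', ← Finset.sum_filter]
  refine Finset.sum_congr ?_ fun _ _ => rfl
  ext p
  simp [and_comm]

theorem wSum_comm (Y Z : Finset V) : wSum G w Y Z = wSum G w Z Y := by
  simp only [wSum_eq_sum_sum]
  rw [Finset.sum_comm]
  simp only [G.adj_comm, Sym2.eq_swap]

theorem wSum_union_left {Y Y' : Finset V} (h : Disjoint Y Y') (Z : Finset V) :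
    wSum G w (Y ∪ Y') Z = wSum G w Y Z + wSum G w Y' Z := by
  simp only [wSum_eq_sum_sum, Finset.sum_union h]

theorem wSum_union_right (Y : Finset V) {Z Z' : Finset V} (h : Disjoint Z Z') :
    wSum G w Y (Z ∪ Z') = wSum G w Y Z + wSum G w Y Z' := by
  simp only [wSum_comm G w Y, wSum_union_left G w h]

theorem sum_wSum_singleton (Y Z : Finset V) :
    ∑ v ∈ Z, wSum G w Y {v} = wSum G w Y Z := by
  simp only [wSum_eq_sum_sum, Finset.sum_singleton]
  exact Finset.sum_comm

theorem wSum_eq_zero {Y Z : Finset V} (h : ∀ u ∈ Y, ∀ v ∈ Z, ¬ G.Adj u v) :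
    wSum G w Y Z = 0 := by
  rw [wSum_eq_sum_sum]
  exact Finset.sum_eq_zero fun u hu => Finset.sum_eq_zero fun v hv => if_neg (h u hu v hv)

end wSum

/-- Let `C` be a vertex cover of the edge-weighted graph `G`, let `X ⊆ C`, and let
`(A, Aᶜ)` be a cut of `G` with `A ∩ C = X`.  Then
`w(A, Aᶜ) = w(X, C \ X) + ∑_{v ∈ A \ C} p_v + ∑_{v ∉ C} w(X, {v})`, where
`p_v = w(C \ X, {v}) - w(X, {v})`. -/
theorem cut_weight_vertex_cover_formula
    {V : Type*} [Fintype V] [DecidableEq V] (G : SimpleGraph V) [DecidableRel G.Adj]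
    (w : Sym2 V → ℝ) (C : Finset V)
    (hC : ∀ ⦃u v : V⦄, G.Adj u v → u ∈ C ∨ v ∈ C)
    (X : Finset V) (hX : X ⊆ C)
    (A : Finset V) (hA : A ∩ C = X) :
    wSum G w A Aᶜ =
      wSum G w X (C \ X) +
        (∑ v ∈ A \ C, (wSum G w (C \ X) {v} - wSum G w X {v})) +
        ∑ v ∈ Cᶜ, wSum G w X {v} := by
  subst hA
  have hA : A = A ∩ C ∪ A \ C := by ext; simp; tauto
  have hAc : Aᶜ = C \ (A ∩ C) ∪ Cᶜ \ A := by ext; simp; tauto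
  have hCc : Cᶜ = A \ C ∪ Cᶜ \ A := by ext; simp; tauto
  have hd : Disjoint (A ∩ C) (A \ C) := by
    simp +contextual [Finset.disjoint_left]
  have hd' : Disjoint (C \ (A ∩ C)) (Cᶜ \ A) := by
    simp +contextual [Finset.disjoint_left]
  have hd'' : Disjoint (A \ C) (Cᶜ \ A) := by
    simp +contextual [Finset.disjoint_left]
  have hcut : wSum G w A Aᶜ = wSum G w (A ∩ C) Aᶜ + wSum G w (A \ C) Aᶜ := by
    rw [← wSum_union_left G w hd, ← hA]
  have hindep : wSum G w (A \ C) (Cᶜ \ A) = 0 := by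
    refine wSum_eq_zero G w fun u hu v hv huv => ?_
    simp only [Finset.mem_sdiff, Finset.mem_compl] at hu hv
    exact (hC huv).elim hu.2 hv.1
  have hout : wSum G w (A ∩ C) Cᶜ =
      wSum G w (A ∩ C) (A \ C) + wSum G w (A ∩ C) (Cᶜ \ A) := by
    rw [← wSum_union_right G w _ hd'', ← hCc]
  rw [hcut, hAc, wSum_union_right G w _ hd', wSum_union_right G w _ hd', hindep,
    Finset.sum_sub_distrib, sum_wSum_singleton, sum_wSum_singleton, sum_wSum_singleton, hout,
    wSum_comm G w (A \ C)]
  ring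
end
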